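/- Let R be a commutative ring and A an associative unital R-algebra. Let M be a ℤ-graded chain complex of left A-modules that is bounded below and such that each M_n is a free A-module. Then M is dg-flat: for every quasi-isomorphism N → N′ of chain complexes of right A-modules, the induced map N ⊗_A M → N′ ⊗_A M is a quasi-isomorphism of R-chain complexes. -/

import Mathlib

open DirectSum MulOpposite
open scoped TensorProduct

/-- Elementwise formulation of "quasi-isomorphism" for a map of ℤ-graded chain complexes
(differentials lower degree by one): the induced map on homology is surjective and
injective in every degree. -/
def IsQIso (X Y : ℤ → Type) [∀ k, AddCommGroup (X k)] [∀ k, AddCommGroup (Y k)]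
    (dX : ∀ k : ℤ, X (k + 1) → X k) (dY : ∀ k : ℤ, Y (k + 1) → Y k)
    (φ : ∀ k : ℤ, X k → Y k) : Prop :=
  ∀ k : ℤ,
    (∀ y : Y (k + 1), dY k y = 0 →
      ∃ x : X (k + 1), dX k x = 0 ∧ ∃ z : Y (k + 1 + 1), φ (k + 1) x - y = dY (k + 1) z) ∧
    (∀ x : X (k + 1), dX k x = 0 → (∃ z : Y (k + 1 + 1), φ (k + 1) x = dY (k + 1) z) →
      ∃ w : X (k + 1 + 1), x = dX (k + 1) w)

/-- The submodule of relations presenting the tensor product `N ⊗_A M` of a right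
`A`-module `N` and a left `A`-module `M` as a quotient of `N ⊗_R M`. -/
abbrev mixedRel (R A : Type) [CommRing R] [Ring A] [Algebra R A]
    (N M : Type) [AddCommGroup N] [Module R N] [Module Aᵐᵒᵖ N]
    [AddCommGroup M] [Module R M] [Module A M] : Submodule R (N ⊗[R] M) :=
  Submodule.span R {x | ∃ (n : N) (a : A) (m : M),
    x = (op a • n) ⊗ₜ[R] m - n ⊗ₜ[R] (a • m)}

/-- The tensor product `N ⊗_A M` over the (possibly noncommutative) `R`-algebra `A`. -/
abbrev TensA (R A : Type) [CommRing R] [Ring A] [Algebra R A]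
    (N M : Type) [AddCommGroup N] [Module R N] [Module Aᵐᵒᵖ N]
    [AddCommGroup M] [Module R M] [Module A M] : Type :=
  (N ⊗[R] M) ⧸ mixedRel R A N M

/-- Degree `k` part of the total tensor product complex `N ⊗_A M` of a complex of right
`A`-modules and a complex of left `A`-modules. -/
abbrev TotT (R A : Type) [CommRing R] [Ring A] [Algebra R A]
    (N : ℤ → Type) [∀ k, AddCommGroup (N k)] [∀ k, Module R (N k)] [∀ k, Module Aᵐᵒᵖ (N k)]
    (M : ℤ → Type) [∀ k, AddCommGroup (M k)] [∀ k, Module R (M k)] [∀ k, Module A (M k)]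
    (k : ℤ) : Type :=
  ⨁ (p : {p : ℤ × ℤ // p.1 + p.2 = k}), TensA R A (N p.1.1) (M p.1.2)

section Helpers

set_option linter.unusedSectionVars false

/-- Comparison for filtered complexes: bounded below exhaustive filtrations and a
quasi-isomorphism on associated graded pieces (stated elementwise). -/
theorem filt_aux {R : Type} [CommRing R] {X Y : ℤ → Type}
    [∀ k, AddCommGroup (X k)] [∀ k, AddCommGroup (Y k)]
    [∀ k, Module R (X k)] [∀ k, Module R (Y k)]
    (dX : ∀ k : ℤ, X (k + 1) →ₗ[R] X k) (dY : ∀ k : ℤ, Y (k + 1) →ₗ[R] Y k)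
    (φ : ∀ k : ℤ, X k →ₗ[R] Y k)
    (ddX : ∀ k x, dX k (dX (k + 1) x) = 0) (ddY : ∀ k x, dY k (dY (k + 1) x) = 0)
    (hc : ∀ k x, φ k (dX k x) = dY k (φ (k + 1) x))
    (FX : ℤ → ∀ k, Submodule R (X k)) (FY : ℤ → ∀ k, Submodule R (Y k))
    (mX : ∀ j k x, x ∈ FX j k → x ∈ FX (j + 1) k)
    (mY : ∀ j k x, x ∈ FY j k → x ∈ FY (j + 1) k)
    (hφ : ∀ j k x, x ∈ FX j k → φ k x ∈ FY j k)
    (b : ℤ) (bX : ∀ k x, x ∈ FX b k → x = 0) (bY : ∀ k x, x ∈ FY b k → x = 0)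
    (gs : ∀ j k, ∀ y ∈ FY (j + 1) (k + 1), dY k y ∈ FY j k →
      ∃ x ∈ FX (j + 1) (k + 1), dX k x ∈ FX j k ∧ ∃ z ∈ FY (j + 1) (k + 1 + 1),
        φ (k + 1) x - y - dY (k + 1) z ∈ FY j (k + 1))
    (gi : ∀ j k, ∀ x ∈ FX (j + 1) (k + 1), dX k x ∈ FX j k →
      ∀ z ∈ FY (j + 1) (k + 1 + 1), φ (k + 1) x - dY (k + 1) z ∈ FY j (k + 1) →
      ∃ w ∈ FX (j + 1) (k + 1 + 1), x - dX (k + 1) w ∈ FX j (k + 1))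
    (n : ℕ) : ∀ k,
      (∀ y ∈ FY (b + n) (k + 1), dY k y = 0 →
        ∃ x ∈ FX (b + n) (k + 1), dX k x = 0 ∧ ∃ z ∈ FY (b + n) (k + 1 + 1),
          φ (k + 1) x - y = dY (k + 1) z) ∧
      (∀ x ∈ FX (b + n) (k + 1), dX k x = 0 → ∀ z ∈ FY (b + n) (k + 1 + 1),
        φ (k + 1) x = dY (k + 1) z →
        ∃ w ∈ FX (b + n) (k + 1 + 1), x = dX (k + 1) w) := by
  induction n with
  | zero =>
    intro k
    simp only [Nat.cast_zero, add_zero]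
    refine ⟨fun y hy _ => ⟨0, zero_mem _, by simp, 0, zero_mem _, ?_⟩,
      fun x hx _ z _ _ => ⟨0, zero_mem _, ?_⟩⟩
    · simp [bY _ _ hy]
    · simp [bX _ _ hx]
  | succ n ih =>
    intro k
    have e : b + ((n + 1 : ℕ) : ℤ) = b + n + 1 := by push_cast; ring
    rw [e]
    generalize b + (n : ℤ) = j at ih
    constructor
    · intro y hy hdy
      obtain ⟨k, rfl⟩ : ∃ k', k = k' + 1 := ⟨k - 1, by ring⟩
      obtain ⟨x0, hx0, hdx0, z0, hz0, he⟩ := gs j _ y hy (by rw [hdy]; exact zero_mem _)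
      obtain ⟨w, hw, hw'⟩ := (ih k).2 (dX _ x0) hdx0 (ddX _ _) _ he (by
        rw [hc, map_sub, map_sub, hdy, ddY]; simp)
      obtain ⟨x1, hx1, hdx1, z1, hz1, h1⟩ := (ih (k + 1)).1
        (φ _ w - (φ _ x0 - y - dY _ z0)) (sub_mem (hφ _ _ _ hw) he) (by
          rw [map_sub, map_sub, map_sub, hdy, ddY, ← hc, ← hc, ← hw']; simp)
      refine ⟨x0 - w + x1, add_mem (sub_mem hx0 (mX _ _ _ hw)) (mX _ _ _ hx1), ?_,
        z0 + z1, add_mem hz0 (mY _ _ _ hz1), ?_⟩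
      · rw [map_add, map_sub, hdx1, hw']; simp
      · rw [map_add (dY _), ← h1, map_add, map_sub]; abel
    · intro x hx hdx z hz hxz
      obtain ⟨w0, hw0, hx'⟩ := gi j _ x hx (by rw [hdx]; exact zero_mem _) z hz
        (by rw [hxz, sub_self]; exact zero_mem _)
      have hz0 : dY (k + 1) (z - φ _ w0) = φ _ (x - dX _ w0) := by
        rw [map_sub, map_sub, hxz, hc]
      obtain ⟨u, hu, hdu, v, hv, he⟩ := gs j (k + 1) (z - φ _ w0)
        (sub_mem hz (hφ _ _ _ hw0)) (by rw [hz0]; exact hφ _ _ _ hx')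
      obtain ⟨w', hw', h⟩ := (ih k).2 (x - dX _ w0 - dX _ u) (sub_mem hx' hdu) (by
          rw [map_sub, map_sub, hdx, ddX, ddX]; simp)
          (-(φ _ u - (z - φ _ w0) - dY _ v)) (neg_mem he) (by
          rw [map_neg, map_sub (dY _), map_sub (dY _), hz0, ddY, ← hc, map_sub (φ _) (x - _)]
          abel)
      refine ⟨w0 + u + w', add_mem (add_mem hw0 hu) (mX _ _ _ hw'), ?_⟩
      rw [map_add, map_add, ← h]; abel

variable {R A : Type} [CommRing R] [Ring A] [Algebra R A]

section Tens

variable {N N' N'' M : Type}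
  [AddCommGroup N] [Module R N] [Module Aᵐᵒᵖ N] [IsScalarTower R Aᵐᵒᵖ N]
  [AddCommGroup N'] [Module R N'] [Module Aᵐᵒᵖ N'] [IsScalarTower R Aᵐᵒᵖ N']
  [AddCommGroup M] [Module R M] [Module A M] [IsScalarTower R A M]

variable (R A) in
/-- pure tensors -/
def tmk (n : N) (m : M) : TensA R A N M := Submodule.Quotient.mk (n ⊗ₜ[R] m)

theorem tens_induction {P : TensA R A N M → Prop} (h0 : P 0) (h : ∀ n m, P (tmk R A n m))
    (ha : ∀ s t, P s → P t → P (s + t)) (t : TensA R A N M) : P t := by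
  obtain ⟨t, rfl⟩ := Submodule.Quotient.mk_surjective _ t
  induction t with
  | zero => exact h0
  | tmul n m => exact h n m
  | add s t hs ht => exact ha _ _ hs ht

theorem tmk_add_left (n n' : N) (m : M) : tmk R A (n + n') m = tmk R A n m + tmk R A n' m := by
  simp only [tmk, TensorProduct.add_tmul, Submodule.Quotient.mk_add]

theorem tmk_add_right (n : N) (m m' : M) : tmk R A n (m + m') = tmk R A n m + tmk R A n m' := by
  simp only [tmk, TensorProduct.tmul_add, Submodule.Quotient.mk_add]

theorem tmk_zero_left (m : M) : tmk R A (0 : N) m = 0 := by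
  simp only [tmk, TensorProduct.zero_tmul, Submodule.Quotient.mk_zero]

theorem tmk_zero_right (n : N) : tmk R A n (0 : M) = 0 := by
  simp only [tmk, TensorProduct.tmul_zero, Submodule.Quotient.mk_zero]

theorem tmk_smul (a : A) (n : N) (m : M) : tmk R A n (a • m) = tmk R A (op a • n) m := by
  symm
  rw [tmk, tmk, Submodule.Quotient.eq]
  exact Submodule.subset_span ⟨n, a, m, rfl⟩

variable (R M) in
/-- functoriality in the right module -/
def tmap (f : N →ₗ[Aᵐᵒᵖ] N') : TensA R A N M →ₗ[R] TensA R A N' M :=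
  Submodule.mapQ _ _ ((f.restrictScalars R).rTensor M) (by
    rw [mixedRel, Submodule.span_le]
    rintro _ ⟨n, a, m, rfl⟩
    simp only [SetLike.mem_coe, Submodule.mem_comap, map_sub, LinearMap.rTensor_tmul,
      LinearMap.coe_restrictScalars, map_smul]
    exact Submodule.subset_span ⟨f n, a, m, rfl⟩)

theorem tmap_tmk (f : N →ₗ[Aᵐᵒᵖ] N') (n : N) (m : M) :
    tmap R M f (tmk R A n m) = tmk R A (f n) m := rfl

variable (R N) in
/-- functoriality in the left module -/
def tmapr {M M' : Type} [AddCommGroup M] [Module R M] [Module A M] [IsScalarTower R A M]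
    [AddCommGroup M'] [Module R M'] [Module A M'] [IsScalarTower R A M']
    (f : M →ₗ[A] M') : TensA R A N M →ₗ[R] TensA R A N M' :=
  Submodule.mapQ _ _ ((f.restrictScalars R).lTensor N) (by
    rw [mixedRel, Submodule.span_le]
    rintro _ ⟨n, a, m, rfl⟩
    simp only [SetLike.mem_coe, Submodule.mem_comap, map_sub, LinearMap.lTensor_tmul,
      LinearMap.coe_restrictScalars, map_smul]
    exact Submodule.subset_span ⟨n, a, f m, rfl⟩)

theorem tmapr_tmk {M M' : Type} [AddCommGroup M] [Module R M] [Module A M] [IsScalarTower R A M]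
    [AddCommGroup M'] [Module R M'] [Module A M'] [IsScalarTower R A M']
    (f : M →ₗ[A] M') (n : N) (m : M) :
    tmapr R N f (tmk R A n m) = tmk R A n (f m) := rfl

theorem tens_ext {V : Type} [AddCommGroup V] [Module R V] {f g : TensA R A N M →ₗ[R] V}
    (h : ∀ n m, f (tmk R A n m) = g (tmk R A n m)) (t) : f t = g t := by
  induction t using tens_induction with
  | h0 => simp
  | h n m => exact h n m
  | ha s t hs ht => rw [map_add, map_add, hs, ht]

theorem tens_ext2 {V : Type} [AddCommGroup V] [Module R V] {f g g' : TensA R A N M →ₗ[R] V}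
    (c : ℤ) (h : ∀ n m, f (tmk R A n m) = g (tmk R A n m) + c • g' (tmk R A n m)) (t) :
    f t = g t + c • g' t :=
  tens_ext (g := g + c • g') h t

/-- the coordinate map -/
def tcoef (N : Type) [AddCommGroup N] [Module R N] [Module Aᵐᵒᵖ N] [IsScalarTower R Aᵐᵒᵖ N]
    (c : M →ₗ[A] A) : TensA R A N M →ₗ[R] N :=
  Submodule.liftQ _ (TensorProduct.lift (LinearMap.mk₂ R (fun (n : N) (m : M) => op (c m) • n)
    (fun n n' m => smul_add _ _ _) (fun r n m => smul_comm _ _ _)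
    (fun n m m' => by simp only [map_add, op_add, add_smul])
    (fun r n m => by
      rw [LinearMap.map_smul_of_tower, op_smul, smul_assoc]))) (by
    rw [mixedRel, Submodule.span_le]
    rintro _ ⟨n, a, m, rfl⟩
    simp [mul_smul])

theorem tcoef_tmk (c : M →ₗ[A] A) (n : N) (m : M) :
    tcoef N c (tmk R A n m) = op (c m) • n := rfl

theorem tcoef_tmap (c : M →ₗ[A] A) (f : N →ₗ[Aᵐᵒᵖ] N') (t : TensA R A N M) :
    tcoef N' c (tmap R M f t) = f (tcoef N c t) := by
  induction t using tens_induction with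
  | h0 => simp
  | h n m => simp only [tmap_tmk, tcoef_tmk, map_smul]
  | ha s t hs ht => simp only [map_add, hs, ht]

theorem tmk_sum_right {ι : Type*} (s : Finset ι) (n : N) (f : ι → M) :
    tmk R A n (∑ i ∈ s, f i) = ∑ i ∈ s, tmk R A n (f i) := by
  classical
  induction s using Finset.induction_on with
  | empty => simp [tmk_zero_right]
  | insert a s ha ih => rw [Finset.sum_insert ha, Finset.sum_insert ha, tmk_add_right, ih]

theorem tens_expand {ι : Type} (b : Module.Basis ι A M) (t : TensA R A N M) :
    ∃ s : Finset ι, ∀ s', s ⊆ s' → t = ∑ i ∈ s', tmk R A (tcoef N (b.coord i) t) (b i) := by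
  classical
  induction t using tens_induction with
  | h0 => exact ⟨∅, fun s' _ => by simp [tmk_zero_left]⟩
  | h n m =>
    refine ⟨(b.repr m).support, fun s' hs' => ?_⟩
    have : m = ∑ i ∈ s', b.repr m i • b i := by
      conv_lhs => rw [← b.linearCombination_repr m]
      rw [Finsupp.linearCombination_apply, Finsupp.sum_of_support_subset _ hs']
      simp
    conv_lhs => rw [this]
    rw [tmk_sum_right]
    refine Finset.sum_congr rfl fun i _ => ?_
    rw [tmk_smul, tcoef_tmk, Module.Basis.coord_apply]
  | ha u v hu hv =>
    obtain ⟨s, hs⟩ := hu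
    obtain ⟨s₁, hs₁⟩ := hv
    refine ⟨s ∪ s₁, fun s' hs' => ?_⟩
    simp only [map_add, tmk_add_left, Finset.sum_add_distrib]
    rw [← hs s' (Finset.union_subset_left hs'), ← hs₁ s' (Finset.union_subset_right hs')]

section Maps

variable {N₁ N₂ N₃ M₁ M₂ M₃ : Type}
  [AddCommGroup N₁] [Module R N₁] [Module Aᵐᵒᵖ N₁] [IsScalarTower R Aᵐᵒᵖ N₁]
  [AddCommGroup N₂] [Module R N₂] [Module Aᵐᵒᵖ N₂] [IsScalarTower R Aᵐᵒᵖ N₂]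
  [AddCommGroup N₃] [Module R N₃] [Module Aᵐᵒᵖ N₃] [IsScalarTower R Aᵐᵒᵖ N₃]
  [AddCommGroup M₁] [Module R M₁] [Module A M₁] [IsScalarTower R A M₁]
  [AddCommGroup M₂] [Module R M₂] [Module A M₂] [IsScalarTower R A M₂]
  [AddCommGroup M₃] [Module R M₃] [Module A M₃] [IsScalarTower R A M₃]

theorem tmap_tmap_zero (f : N₂ →ₗ[Aᵐᵒᵖ] N₃) (g : N₁ →ₗ[Aᵐᵒᵖ] N₂) (h : f.comp g = 0)
    (t : TensA R A N₁ M) : tmap R M f (tmap R M g t) = 0 := by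
  induction t using tens_induction with
  | h0 => simp
  | h n m =>
    have h1 : f (g n) = 0 := LinearMap.congr_fun h n
    rw [tmap_tmk, tmap_tmk, h1, tmk_zero_left]
  | ha s t hs ht => rw [map_add, map_add, hs, ht, add_zero]

theorem tmapr_tmapr_zero (f : M₂ →ₗ[A] M₃) (g : M₁ →ₗ[A] M₂) (h : f.comp g = 0)
    (t : TensA R A N M₁) : tmapr R N f (tmapr R N g t) = 0 := by
  induction t using tens_induction with
  | h0 => simp
  | h n m =>
    have h1 : f (g m) = 0 := LinearMap.congr_fun h m
    rw [tmapr_tmk, tmapr_tmk, h1, tmk_zero_right]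
  | ha s t hs ht => rw [map_add, map_add, hs, ht, add_zero]

theorem tmap_tmapr (f : N₁ →ₗ[Aᵐᵒᵖ] N₂) (g : M₁ →ₗ[A] M₂) (t : TensA R A N₁ M₁) :
    tmap R M₂ f (tmapr R N₁ g t) = tmapr R N₂ g (tmap R M₁ f t) := by
  induction t using tens_induction with
  | h0 => simp
  | h n m => rfl
  | ha s t hs ht => simp only [map_add, hs, ht]

theorem tmap_tmap_comm (f : N₂ →ₗ[Aᵐᵒᵖ] N₃) (g : N₁ →ₗ[Aᵐᵒᵖ] N₂)
    (f' : N →ₗ[Aᵐᵒᵖ] N₃) (g' : N₁ →ₗ[Aᵐᵒᵖ] N) (h : f.comp g = f'.comp g')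
    (t : TensA R A N₁ M) : tmap R M f (tmap R M g t) = tmap R M f' (tmap R M g' t) := by
  induction t using tens_induction with
  | h0 => simp
  | h n m =>
    have h1 : f (g n) = f' (g' n) := LinearMap.congr_fun h n
    rw [tmap_tmk, tmap_tmk, tmap_tmk, tmap_tmk, h1]
  | ha s t hs ht => simp only [map_add, hs, ht]

end Maps

end Tens

/-- one column -/
theorem col_qis {M : Type} [AddCommGroup M] [Module R M] [Module A M] [IsScalarTower R A M]
    (hfree : Module.Free A M)
    {N N' : ℤ → Type}
    [∀ k, AddCommGroup (N k)] [∀ k, Module R (N k)] [∀ k, Module Aᵐᵒᵖ (N k)]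
    [∀ k, IsScalarTower R Aᵐᵒᵖ (N k)]
    [∀ k, AddCommGroup (N' k)] [∀ k, Module R (N' k)] [∀ k, Module Aᵐᵒᵖ (N' k)]
    [∀ k, IsScalarTower R Aᵐᵒᵖ (N' k)]
    (dN : ∀ k : ℤ, N (k + 1) →ₗ[Aᵐᵒᵖ] N k)
    (dN' : ∀ k : ℤ, N' (k + 1) →ₗ[Aᵐᵒᵖ] N' k)
    (φ : ∀ k : ℤ, N k →ₗ[Aᵐᵒᵖ] N' k)
    (hq : IsQIso N N' (fun k => dN k) (fun k => dN' k) (fun k => φ k)) :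
    IsQIso (fun k => TensA R A (N k) M) (fun k => TensA R A (N' k) M)
      (fun k => tmap R M (dN k)) (fun k => tmap R M (dN' k)) (fun k => tmap R M (φ k)) := by
  have b := Module.Free.chooseBasis A M
  intro k
  constructor
  · intro y hy
    beta_reduce at y hy
    obtain ⟨s, hs⟩ := tens_expand b y
    have h (i) := (hq k).1 (tcoef _ (b.coord i) y) (by
      beta_reduce
      rw [← tcoef_tmap, hy, map_zero])
    choose x hx z hz using h
    refine ⟨∑ i ∈ s, tmk R A (x i) (b i), ?_, ∑ i ∈ s, tmk R A (z i) (b i), ?_⟩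
    · simp only [map_sum, tmap_tmk, hx, tmk_zero_left, Finset.sum_const_zero]
    · rw [sub_eq_iff_eq_add]
      conv_rhs => rw [hs s subset_rfl]
      simp only [map_sum, tmap_tmk, ← hz]
      rw [← Finset.sum_add_distrib]
      refine Finset.sum_congr rfl fun i _ => ?_
      rw [← tmk_add_left, sub_add_cancel]
  · rintro x hx ⟨z, hz⟩
    beta_reduce at x hx z hz
    obtain ⟨s, hs⟩ := tens_expand b x
    have h (i) := (hq k).2 (tcoef _ (b.coord i) x) (by
      beta_reduce
      rw [← tcoef_tmap, hx, map_zero]) ⟨tcoef _ (b.coord i) z, by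
        beta_reduce
        rw [← tcoef_tmap, ← tcoef_tmap, hz]⟩
    choose w hw using h
    refine ⟨∑ i ∈ s, tmk R A (w i) (b i), ?_⟩
    simp only [map_sum, tmap_tmk, ← hw]
    exact hs s subset_rfl

section Tot

/-- total object of a bigraded family -/
abbrev GTot (C : ℤ → ℤ → Type) [∀ i j, AddCommGroup (C i j)] (k : ℤ) : Type :=
  ⨁ (p : {p : ℤ × ℤ // p.1 + p.2 = k}), C p.1.1 p.1.2

variable {C : ℤ → ℤ → Type} [∀ i j, AddCommGroup (C i j)] [∀ i j, Module R (C i j)]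

variable (R C) in
/-- inclusion of a summand -/
def tin (k i j : ℤ) (h : i + j = k) : C i j →ₗ[R] GTot C k :=
  DirectSum.lof R {p : ℤ × ℤ // p.1 + p.2 = k} (fun p => C p.1.1 p.1.2) ⟨(i, j), h⟩

variable (R C) in
/-- the filtration by the second degree -/
def tfil (j k : ℤ) : Submodule R (GTot C k) where
  carrier := {x | ∀ p : {p : ℤ × ℤ // p.1 + p.2 = k}, j < p.1.2 → x p = 0}
  zero_mem' := fun p _ => rfl
  add_mem' := fun {x y} hx hy p hp => by
    rw [DirectSum.add_apply, hx p hp, hy p hp, add_zero]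
  smul_mem' := fun r x hx p hp => by
    rw [DirectSum.smul_apply, hx p hp, smul_zero]

theorem tin_mem {k i j j' : ℤ} (h : i + j = k) (hj : j ≤ j') (t : C i j) :
    tin R C k i j h t ∈ tfil R C j' k := by
  intro p hp
  refine DirectSum.of_eq_of_ne _ _ _ ?_
  rintro rfl
  exact absurd hp (not_lt.2 hj)

theorem tin_mem_pred {k i j : ℤ} (h : i + (j + 1) = k) (t : C i (j + 1))
    (ht : tin R C k i (j + 1) h t ∈ tfil R C j k) : t = 0 := by
  have := ht ⟨(i, j + 1), h⟩ (by simp)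
  rw [← this]
  exact (DirectSum.of_eq_same (β := fun p : {p : ℤ × ℤ // p.1 + p.2 = k} =>
    C p.1.1 p.1.2) ⟨(i, j + 1), h⟩ t).symm

theorem tfil_top {k i j : ℤ} (h : i + (j + 1) = k) (x : GTot C k)
    (hx : x ∈ tfil R C (j + 1) k) :
    ∃ t, x - tin R C k i (j + 1) h t ∈ tfil R C j k := by
  refine ⟨x ⟨(i, j + 1), h⟩, ?_⟩
  intro p hp
  rw [DirectSum.sub_apply]
  by_cases hpe : p = ⟨(i, j + 1), h⟩
  · subst hpe
    rw [sub_eq_zero]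
    exact (DirectSum.of_eq_same (β := fun p : {p : ℤ × ℤ // p.1 + p.2 = k} =>
      C p.1.1 p.1.2) _ _).symm
  · have hlt : j + 1 < p.1.2 := by
      by_contra hcon
      apply hpe
      obtain ⟨⟨a, c⟩, hac⟩ := p
      have : c = j + 1 := by simp only at hp hcon; omega
      subst this
      have : a = i := by simp only at hac; omega
      subst this
      rfl
    rw [hx p hlt, zero_sub, neg_eq_zero]
    exact DirectSum.of_eq_of_ne _ _ _ hpe

theorem tfil_mono {k j j' : ℤ} (hj : j ≤ j') {x : GTot C k}
    (hx : x ∈ tfil R C j k) : x ∈ tfil R C j' k :=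
  fun p hp => hx p (lt_of_le_of_lt hj hp)

variable (R) in
theorem tot_induction {k : ℤ} {P : GTot C k → Prop} (h0 : P 0)
    (h : ∀ i j (h : i + j = k) (t : C i j), P (tin R C k i j h t))
    (ha : ∀ s t, P s → P t → P (s + t)) (t : GTot C k) : P t := by
  classical
  induction t using DirectSum.induction_on with
  | zero => exact h0
  | of p t =>
    obtain ⟨⟨i, j⟩, hp⟩ := p
    exact h i j hp t
  | add s t hs ht => exact ha _ _ hs ht

theorem tfil_exhaust {k : ℤ} (b : ℤ) (x : GTot C k) :
    ∃ n : ℕ, x ∈ tfil R C (b + n) k := by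
  refine tot_induction R (P := fun x => ∃ n : ℕ, x ∈ tfil R C (b + n) k) ⟨0, zero_mem _⟩
    (fun i j h t => ⟨(j - b).toNat, tin_mem _ (by omega) _⟩) ?_ x
  rintro s t ⟨n, hn⟩ ⟨m, hm⟩
  exact ⟨max n m, add_mem (tfil_mono (by push_cast; omega) hn)
    (tfil_mono (by push_cast; omega) hm)⟩

theorem tfil_bot {k : ℤ} (b : ℤ) (hb : ∀ i j : ℤ, j ≤ b → ∀ t : C i j, t = 0)
    (x : GTot C k) (hx : x ∈ tfil R C b k) : x = 0 := by
  refine DFinsupp.ext fun p => ?_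
  by_cases hp : b < p.1.2
  · exact hx p hp
  · exact hb _ _ (not_lt.1 hp) _

/-- elements of the filtration are sums of homogeneous ones -/
theorem tfil_induction {j k : ℤ} {x : GTot C k} (hx : x ∈ tfil R C j k)
    {V : Type} [AddCommGroup V] [Module R V] (S : Submodule R V) (f : GTot C k →ₗ[R] V)
    (h : ∀ a c (hac : a + c = k), c ≤ j → ∀ t, f (tin R C k a c hac t) ∈ S) : f x ∈ S := by
  classical
  rw [← DirectSum.sum_support_of x, map_sum]
  refine sum_mem fun p _ => ?_
  by_cases hp : j < p.1.2
  · rw [hx p hp, map_zero, map_zero]; exact zero_mem _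
  · obtain ⟨⟨a, c⟩, hac⟩ := p
    exact h a c hac (not_lt.1 hp) _

variable {dh : ∀ i j : ℤ, C (i + 1) j →ₗ[R] C i j} {dv : ∀ i j : ℤ, C i (j + 1) →ₗ[R] C i j}
  {dT : ∀ k : ℤ, GTot C (k + 1) →ₗ[R] GTot C k}

/-- the defining formula of the total differential -/
def DiffFormula (dh : ∀ i j : ℤ, C (i + 1) j →ₗ[R] C i j)
    (dv : ∀ i j : ℤ, C i (j + 1) →ₗ[R] C i j)
    (dT : ∀ k : ℤ, GTot C (k + 1) →ₗ[R] GTot C k) : Prop :=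
  ∀ (k i j : ℤ) (h : i + 1 + (j + 1) = k + 1) (t : C (i + 1) (j + 1)),
    dT k (tin R C (k + 1) (i + 1) (j + 1) h t) =
      tin R C k i (j + 1) (by omega) (dh i (j + 1) t) +
      ((i + 1).negOnePow : ℤ) • tin R C k (i + 1) j (by omega) (dv (i + 1) j t)

theorem dT_tin (hd : DiffFormula dh dv dT) (k i j : ℤ) (h : i + 1 + (j + 1) = k + 1)
    (t : C (i + 1) (j + 1)) :
    dT k (tin R C (k + 1) (i + 1) (j + 1) h t) -
      tin R C k i (j + 1) (by omega) (dh i (j + 1) t) ∈ tfil R C j k := by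
  rw [hd, add_sub_cancel_left]
  exact zsmul_mem (tin_mem _ le_rfl _) _

theorem ddT (hd : DiffFormula dh dv dT) (hh : ∀ i j t, dh i j (dh (i + 1) j t) = 0)
    (hv : ∀ i j t, dv i j (dv i (j + 1) t) = 0)
    (hhv : ∀ i j t, dh i j (dv (i + 1) j t) = dv i j (dh i (j + 1) t))
    (k : ℤ) (x) : dT k (dT (k + 1) x) = 0 := by
  refine tot_induction R (P := fun x => dT k (dT (k + 1) x) = 0) (by simp) ?_ ?_ x
  · intro i j h t
    obtain ⟨i, rfl⟩ : ∃ i', i = i' + 1 + 1 := ⟨i - 2, by ring⟩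
    obtain ⟨j, rfl⟩ : ∃ j', j = j' + 1 + 1 := ⟨j - 2, by ring⟩
    rw [hd, map_add, map_zsmul, hd k i (j + 1), hd k (i + 1) j, hh, hv, hhv,
      Int.negOnePow_succ (i + 1)]
    simp
  · intro s t hs ht
    simp only [map_add, hs, ht, add_zero]

theorem dT_fil (hd : DiffFormula dh dv dT) {j k : ℤ} {x} (hx : x ∈ tfil R C j (k + 1)) :
    dT k x ∈ tfil R C j k := by
  refine tfil_induction hx _ _ ?_
  intro a c hac hc t
  obtain ⟨a, rfl⟩ : ∃ i', a = i' + 1 := ⟨a - 1, by ring⟩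
  obtain ⟨c, rfl⟩ : ∃ i', c = i' + 1 := ⟨c - 1, by ring⟩
  rw [hd]
  exact add_mem (tin_mem _ hc _) (zsmul_mem (tin_mem _ (by omega) _) _)

/-- leading term of the differential of an element with given leading term -/
theorem dT_top (hd : DiffFormula dh dv dT) {k i j : ℤ} (h : i + 1 + (j + 1) = k + 1)
    {x} {t} (hx : x - tin R C (k + 1) (i + 1) (j + 1) h t ∈ tfil R C j (k + 1)) :
    dT k x - tin R C k i (j + 1) (by omega) (dh i (j + 1) t) ∈ tfil R C j k := by
  have h1 := dT_fil hd hx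
  have h2 := add_mem h1 (dT_tin hd k i j h t)
  rw [map_sub, sub_add_sub_cancel] at h2
  exact h2

/-- A map of double complexes, bounded below in the second direction, which is a
quasi-isomorphism on each column, is a quasi-isomorphism on total complexes. -/
theorem double_qis {C' : ℤ → ℤ → Type} [∀ i j, AddCommGroup (C' i j)] [∀ i j, Module R (C' i j)]
    {dh' : ∀ i j : ℤ, C' (i + 1) j →ₗ[R] C' i j} {dv' : ∀ i j : ℤ, C' i (j + 1) →ₗ[R] C' i j}
    {dT' : ∀ k : ℤ, GTot C' (k + 1) →ₗ[R] GTot C' k}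
    (hd : DiffFormula dh dv dT) (hd' : DiffFormula dh' dv' dT')
    (hh : ∀ i j t, dh i j (dh (i + 1) j t) = 0)
    (hv : ∀ i j t, dv i j (dv i (j + 1) t) = 0)
    (hhv : ∀ i j t, dh i j (dv (i + 1) j t) = dv i j (dh i (j + 1) t))
    (hh' : ∀ i j t, dh' i j (dh' (i + 1) j t) = 0)
    (hv' : ∀ i j t, dv' i j (dv' i (j + 1) t) = 0)
    (hhv' : ∀ i j t, dh' i j (dv' (i + 1) j t) = dv' i j (dh' i (j + 1) t))
    (f : ∀ i j, C i j →ₗ[R] C' i j)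
    (fh : ∀ i j t, f i j (dh i j t) = dh' i j (f (i + 1) j t))
    (fv : ∀ i j t, f i j (dv i j t) = dv' i j (f i (j + 1) t))
    (Φ : ∀ k : ℤ, GTot C k →ₗ[R] GTot C' k)
    (hP : ∀ (k i j : ℤ) (h : i + j = k) (t : C i j),
      Φ k (tin R C k i j h t) = tin R C' k i j h (f i j t))
    (b : ℤ) (hb : ∀ i j : ℤ, j ≤ b → ∀ t : C i j, t = 0)
    (hb' : ∀ i j : ℤ, j ≤ b → ∀ t : C' i j, t = 0)
    (hcol : ∀ j, IsQIso (fun i => C i j) (fun i => C' i j) (fun i => dh i j) (fun i => dh' i j)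
      (fun i => f i j)) :
    IsQIso (GTot C) (GTot C') (fun k => dT k) (fun k => dT' k) (fun k => Φ k) := by
  have hc : ∀ k x, Φ k (dT k x) = dT' k (Φ (k + 1) x) := by
    intro k x
    refine tot_induction R (P := fun x => Φ k (dT k x) = dT' k (Φ (k + 1) x)) (by simp) ?_ ?_ x
    · intro i j h t
      obtain ⟨i, rfl⟩ : ∃ i', i = i' + 1 := ⟨i - 1, by ring⟩
      obtain ⟨j, rfl⟩ : ∃ j', j = j' + 1 := ⟨j - 1, by ring⟩
      rw [hd, map_add, map_zsmul, hP, hP, hP, hd', fh, fv]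
    · intro s t hs ht
      simp only [map_add, hs, ht]
  have hF : ∀ j k x, x ∈ tfil R C j k → Φ k x ∈ tfil R C' j k := by
    intro j k x hx
    refine tfil_induction hx _ _ ?_
    intro a c hac hc t
    rw [hP]
    exact tin_mem _ hc _
  have hFt : ∀ {k i j : ℤ} (h : i + (j + 1) = k) {x t},
      x - tin R C k i (j + 1) h t ∈ tfil R C j k →
      Φ k x - tin R C' k i (j + 1) h (f _ _ t) ∈ tfil R C' j k := by
    intro k i j h x t hx
    have := hF _ _ _ hx
    rwa [map_sub, hP] at this
  have key := filt_aux dT dT' Φ (ddT hd hh hv hhv) (ddT hd' hh' hv' hhv') hc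
    (tfil R C) (tfil R C')
    (fun j k x hx => tfil_mono (by omega) hx) (fun j k x hx => tfil_mono (by omega) hx) hF
    b (fun k x hx => tfil_bot _ hb x hx) (fun k x hx => tfil_bot _ hb' x hx) ?_ ?_
  · intro k
    constructor
    · intro y hy
      obtain ⟨n, hn⟩ := tfil_exhaust (R := R) b y
      obtain ⟨x, _, hx, z, _, hz⟩ := (key n k).1 y hn hy
      exact ⟨x, hx, z, hz⟩
    · rintro x hx ⟨z, hz⟩
      obtain ⟨n, hn⟩ := tfil_exhaust (R := R) b x
      obtain ⟨m, hm⟩ := tfil_exhaust (R := R) b z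
      obtain ⟨w, _, hw⟩ := (key (max n m) k).2 x (tfil_mono (by push_cast; omega) hn) hx z
        (tfil_mono (by push_cast; omega) hm) hz
      exact ⟨w, hw⟩
  · intro j k y hy hdy
    obtain ⟨i, hi⟩ : ∃ i : ℤ, i + 1 + (j + 1) = k + 1 := ⟨k - j - 1, by ring⟩
    have hi0 : i + (j + 1) = k := by omega
    have hi1 : i + 1 + 1 + (j + 1) = k + 1 + 1 := by omega
    obtain ⟨t, ht⟩ := tfil_top hi y hy
    have h0 : dh' _ _ t = 0 := by
      refine tin_mem_pred (R := R) hi0 _ ?_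
      have := sub_mem hdy (dT_top hd' hi ht)
      rwa [sub_sub_cancel] at this
    obtain ⟨x, hx, z, hz⟩ := (hcol (j + 1) i).1 t h0
    refine ⟨tin R C _ _ _ hi x, tin_mem _ le_rfl _, ?_,
      tin R C' _ _ _ hi1 z, tin_mem _ le_rfl _, ?_⟩
    · have := dT_tin hd k i j hi x
      simp only at hx
      rwa [hx, map_zero, sub_zero] at this
    · have h1 := dT_tin hd' (k + 1) (i + 1) j hi1 z
      simp only at hz
      rw [← hz, map_sub] at h1
      rw [hP]
      have h2 := neg_mem (add_mem h1 ht)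
      convert h2 using 1
      abel
  · intro j k x hx hdx z hz hxz
    obtain ⟨i, hi⟩ : ∃ i : ℤ, i + 1 + (j + 1) = k + 1 := ⟨k - j - 1, by ring⟩
    have hi0 : i + (j + 1) = k := by omega
    have hi1 : i + 1 + 1 + (j + 1) = k + 1 + 1 := by omega
    obtain ⟨t, ht⟩ := tfil_top hi x hx
    obtain ⟨s, hs⟩ := tfil_top hi1 z hz
    have h0 : dh _ _ t = 0 := by
      refine tin_mem_pred (R := R) hi0 _ ?_
      have := sub_mem hdx (dT_top hd hi ht)
      rwa [sub_sub_cancel] at this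
    have h1 : f _ _ t = dh' _ _ s := by
      rw [← sub_eq_zero]
      refine tin_mem_pred (R := R) hi _ ?_
      have := add_mem (sub_mem hxz (hFt hi ht)) (dT_top hd' hi1 hs)
      rw [map_sub]
      convert this using 1
      abel
    obtain ⟨w, hw⟩ := (hcol (j + 1) i).2 t h0 ⟨s, h1⟩
    refine ⟨tin R C _ _ _ hi1 w, tin_mem _ le_rfl _, ?_⟩
    have h2 := dT_tin hd (k + 1) (i + 1) j hi1 w
    simp only at hw
    rw [← hw] at h2
    have h3 := sub_mem ht h2
    convert h3 using 1
    abel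

end Tot

end Helpers

/-- A bounded below, degreewise free chain complex `M` of left `A`-modules is dg-flat:
for any quasi-isomorphism `φ : N → N'` of chain complexes of right `A`-modules, the
induced map `N ⊗_A M → N' ⊗_A M` on total tensor product complexes is a
quasi-isomorphism of `R`-chain complexes. -/
theorem stmt_7 (R : Type) [CommRing R] (A : Type) [Ring A] [Algebra R A]
    -- the complex of left `A`-modules `M`, bounded below and degreewise free
    (M : ℤ → Type) [∀ k, AddCommGroup (M k)] [∀ k, Module R (M k)]
    [∀ k, Module A (M k)] [∀ k, IsScalarTower R A (M k)]
    (dM : ∀ k : ℤ, M (k + 1) →ₗ[A] M k)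
    (hdM : ∀ k, (dM k).comp (dM (k + 1)) = 0)
    (hbdd : ∃ b : ℤ, ∀ k : ℤ, k < b → Subsingleton (M k))
    (hfree : ∀ k, Module.Free A (M k))
    -- complexes of right `A`-modules `N`, `N'`
    (N N' : ℤ → Type)
    [∀ k, AddCommGroup (N k)] [∀ k, Module R (N k)] [∀ k, Module Aᵐᵒᵖ (N k)]
    [∀ k, IsScalarTower R Aᵐᵒᵖ (N k)]
    [∀ k, AddCommGroup (N' k)] [∀ k, Module R (N' k)] [∀ k, Module Aᵐᵒᵖ (N' k)]
    [∀ k, IsScalarTower R Aᵐᵒᵖ (N' k)]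
    (dN : ∀ k : ℤ, N (k + 1) →ₗ[Aᵐᵒᵖ] N k)
    (hdN : ∀ k, (dN k).comp (dN (k + 1)) = 0)
    (dN' : ∀ k : ℤ, N' (k + 1) →ₗ[Aᵐᵒᵖ] N' k)
    (hdN' : ∀ k, (dN' k).comp (dN' (k + 1)) = 0)
    -- a quasi-isomorphism `φ : N → N'`
    (φ : ∀ k : ℤ, N k →ₗ[Aᵐᵒᵖ] N' k)
    (hφchain : ∀ k, (φ k).comp (dN k) = (dN' k).comp (φ (k + 1)))
    (hφqis : IsQIso N N' (fun k => dN k) (fun k => dN' k) (fun k => φ k))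
    -- the differentials of the total tensor product complexes
    (dT : ∀ k : ℤ, TotT R A N M (k + 1) →ₗ[R] TotT R A N M k)
    (hdT : ∀ (k i j : ℤ) (h : i + 1 + (j + 1) = k + 1) (x : N (i + 1)) (y : M (j + 1)),
      dT k (DirectSum.lof R {p : ℤ × ℤ // p.1 + p.2 = k + 1}
          (fun p => TensA R A (N p.1.1) (M p.1.2)) ⟨(i + 1, j + 1), h⟩
          (Submodule.Quotient.mk (x ⊗ₜ[R] y))) =
        DirectSum.lof R {p : ℤ × ℤ // p.1 + p.2 = k}
            (fun p => TensA R A (N p.1.1) (M p.1.2)) ⟨(i, j + 1), by omega⟩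
            (Submodule.Quotient.mk ((dN i x) ⊗ₜ[R] y))
        + ((i + 1).negOnePow : ℤ) •
            DirectSum.lof R {p : ℤ × ℤ // p.1 + p.2 = k}
              (fun p => TensA R A (N p.1.1) (M p.1.2)) ⟨(i + 1, j), by omega⟩
              (Submodule.Quotient.mk (x ⊗ₜ[R] (dM j y))))
    (dT' : ∀ k : ℤ, TotT R A N' M (k + 1) →ₗ[R] TotT R A N' M k)
    (hdT' : ∀ (k i j : ℤ) (h : i + 1 + (j + 1) = k + 1) (x : N' (i + 1)) (y : M (j + 1)),
      dT' k (DirectSum.lof R {p : ℤ × ℤ // p.1 + p.2 = k + 1}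
          (fun p => TensA R A (N' p.1.1) (M p.1.2)) ⟨(i + 1, j + 1), h⟩
          (Submodule.Quotient.mk (x ⊗ₜ[R] y))) =
        DirectSum.lof R {p : ℤ × ℤ // p.1 + p.2 = k}
            (fun p => TensA R A (N' p.1.1) (M p.1.2)) ⟨(i, j + 1), by omega⟩
            (Submodule.Quotient.mk ((dN' i x) ⊗ₜ[R] y))
        + ((i + 1).negOnePow : ℤ) •
            DirectSum.lof R {p : ℤ × ℤ // p.1 + p.2 = k}
              (fun p => TensA R A (N' p.1.1) (M p.1.2)) ⟨(i + 1, j), by omega⟩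
              (Submodule.Quotient.mk (x ⊗ₜ[R] (dM j y))))
    -- the induced map `N ⊗_A M → N' ⊗_A M`
    (Φ : ∀ k : ℤ, TotT R A N M k →ₗ[R] TotT R A N' M k)
    (hΦ : ∀ (k i j : ℤ) (h : i + j = k) (x : N i) (y : M j),
      Φ k (DirectSum.lof R {p : ℤ × ℤ // p.1 + p.2 = k}
          (fun p => TensA R A (N p.1.1) (M p.1.2)) ⟨(i, j), h⟩
          (Submodule.Quotient.mk (x ⊗ₜ[R] y))) =
        DirectSum.lof R {p : ℤ × ℤ // p.1 + p.2 = k}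
          (fun p => TensA R A (N' p.1.1) (M p.1.2)) ⟨(i, j), h⟩
          (Submodule.Quotient.mk ((φ i x) ⊗ₜ[R] y))) :
    IsQIso (TotT R A N M) (TotT R A N' M)
      (fun k => dT k) (fun k => dT' k) (fun k => Φ k) := by
  obtain ⟨b, hb⟩ := hbdd
  have hb0 : ∀ j : ℤ, j ≤ b - 1 → ∀ (L : Type) [AddCommGroup L] [Module R L] [Module Aᵐᵒᵖ L]
      [IsScalarTower R Aᵐᵒᵖ L], ∀ t : TensA R A L (M j), t = 0 := by
    intro j hj L _ _ _ _ t
    have := hb j (by omega)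
    induction t using tens_induction with
    | h0 => rfl
    | h n m => rw [Subsingleton.elim m 0, tmk_zero_right]
    | ha s t hs ht => rw [hs, ht, add_zero]
  refine double_qis (R := R)
    (C := fun i j => TensA R A (N i) (M j)) (C' := fun i j => TensA R A (N' i) (M j))
    (dh := fun i j => tmap R (M j) (dN i)) (dh' := fun i j => tmap R (M j) (dN' i))
    (dv := fun i j => tmapr R (N i) (dM j)) (dv' := fun i j => tmapr R (N' i) (dM j))
    (dT := dT) (dT' := dT') ?_ ?_ ?_ ?_ ?_ ?_ ?_ ?_ (fun i j => tmap R (M j) (φ i)) ?_ ?_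
    Φ ?_ (b - 1) (fun i j hj t => hb0 j hj _ t) (fun i j hj t => hb0 j hj _ t)
    (fun j => col_qis (hfree j) dN dN' φ hφqis)
  · intro k i j h t
    exact tens_ext2 (f := (dT k).comp (tin R (fun i j => TensA R A (N i) (M j)) _ _ _ h))
      (g := (tin R (fun i j => TensA R A (N i) (M j)) _ _ _ _).comp (tmap R (M (j + 1)) (dN i)))
      (g' := (tin R (fun i j => TensA R A (N i) (M j)) _ _ _ _).comp (tmapr R _ (dM j)))
      _ (hdT k i j h) t
  · intro k i j h t
    exact tens_ext2 (f := (dT' k).comp (tin R (fun i j => TensA R A (N' i) (M j)) _ _ _ h))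
      (g := (tin R (fun i j => TensA R A (N' i) (M j)) _ _ _ _).comp (tmap R (M (j + 1)) (dN' i)))
      (g' := (tin R (fun i j => TensA R A (N' i) (M j)) _ _ _ _).comp (tmapr R _ (dM j)))
      _ (hdT' k i j h) t
  · exact fun i j t => tmap_tmap_zero _ _ (hdN i) t
  · exact fun i j t => tmapr_tmapr_zero _ _ (hdM j) t
  · exact fun i j t => tmap_tmapr _ _ t
  · exact fun i j t => tmap_tmap_zero _ _ (hdN' i) t
  · exact fun i j t => tmapr_tmapr_zero _ _ (hdM j) t
  · exact fun i j t => tmap_tmapr _ _ t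
  · exact fun i j t => tmap_tmap_comm _ _ _ _ (hφchain i) t
  · exact fun i j t => tmap_tmapr _ _ t
  · intro k i j h t
    exact tens_ext (f := (Φ k).comp (tin R (fun i j => TensA R A (N i) (M j)) _ _ _ h))
      (g := (tin R (fun i j => TensA R A (N' i) (M j)) _ _ _ h).comp (tmap R (M j) (φ i)))
      (hΦ k i j h) t
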